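/- arXiv:2512.16777 — 13 statements merged into one kernel-verified Lean document; each statement's English description precedes it below -/
import Mathlib

section
/- Let ρ be a 2×2 density matrix. Then ρ does not lie in the convex hull of the six single-qubit stabilizer pure states if and only if there exist three matrices ψ1, ψ2, ψ3 among the six single-qubit stabilizer pure states with Tr(ψi ψj) = 1/2 for all i ≠ j such that Tr(ρ ψ1) > Tr(ρ ψ2) + Tr(ρ ψ3). (Triangle Criterion: it is sound and detects all single-qubit mixed magic states.) -/
open Matrix
open scoped ComplexOrder

/-- The six single-qubit stabilizer pure states as 2×2 complex matrices. -/
noncomputable def ket0bra0 : Matrix (Fin 2) (Fin 2) ℂ := !![1, 0; 0, 0]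
noncomputable def ket1bra1 : Matrix (Fin 2) (Fin 2) ℂ := !![0, 0; 0, 1]
noncomputable def ketPbraP : Matrix (Fin 2) (Fin 2) ℂ := !![1/2, 1/2; 1/2, 1/2]
noncomputable def ketMbraM : Matrix (Fin 2) (Fin 2) ℂ := !![1/2, -(1/2); -(1/2), 1/2]
noncomputable def ketPIbraPI : Matrix (Fin 2) (Fin 2) ℂ :=
  !![1/2, -Complex.I/2; Complex.I/2, 1/2]
noncomputable def ketMIbraMI : Matrix (Fin 2) (Fin 2) ℂ :=
  !![1/2, Complex.I/2; -Complex.I/2, 1/2]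

noncomputable def stabStates : Set (Matrix (Fin 2) (Fin 2) ℂ) :=
  {ket0bra0, ket1bra1, ketPbraP, ketMbraM, ketPIbraPI, ketMIbraMI}

/-- The Hermitian matrix of trace one with Bloch vector `(x, y, z)`. -/
noncomputable def blochMatrix (x y z : ℝ) : Matrix (Fin 2) (Fin 2) ℂ :=
  !![(1 + z) / 2, (x - y * Complex.I) / 2; (x + y * Complex.I) / 2, (1 - z) / 2]

theorem Matrix.IsHermitian.exists_eq_blochMatrix {ρ : Matrix (Fin 2) (Fin 2) ℂ}
    (hρ : ρ.IsHermitian) (htr : ρ.trace = 1) : ∃ x y z : ℝ, ρ = blochMatrix x y z := by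
  have h00 := hρ.apply 0 0
  have h11 := hρ.apply 1 1
  have h01 := hρ.apply 0 1
  simp only [Matrix.trace_fin_two, Complex.ext_iff, Complex.star_def, Complex.conj_re,
    Complex.conj_im, Complex.add_re, Complex.add_im, Complex.one_re, Complex.one_im]
    at htr h00 h11 h01
  refine ⟨2 * (ρ 1 0).re, 2 * (ρ 1 0).im, (ρ 0 0).re - (ρ 1 1).re, ?_⟩
  ext i j
  fin_cases i <;> fin_cases j <;> apply Complex.ext <;> simp [blochMatrix] <;> linarith

theorem trace_blochMatrix_mul (x y z a b c : ℝ) :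
    (blochMatrix x y z * blochMatrix a b c).trace =
      (((1 + x * a + y * b + z * c) / 2 : ℝ) : ℂ) := by
  apply Complex.ext <;> simp [blochMatrix, Matrix.trace_fin_two] <;> ring

theorem stabStates_eq_blochMatrix :
    stabStates = {blochMatrix 0 0 1, blochMatrix 0 0 (-1), blochMatrix 1 0 0,
      blochMatrix (-1) 0 0, blochMatrix 0 1 0, blochMatrix 0 (-1) 0} := by
  have h0 : ket0bra0 = blochMatrix 0 0 1 := by
    simp [ket0bra0, blochMatrix]
  have h1 : ket1bra1 = blochMatrix 0 0 (-1) := by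
    simp [ket1bra1, blochMatrix]
  have h2 : ketPbraP = blochMatrix 1 0 0 := by
    simp [ketPbraP, blochMatrix]
  have h3 : ketMbraM = blochMatrix (-1) 0 0 := by
    simp [ketMbraM, blochMatrix]; norm_num
  have h4 : ketPIbraPI = blochMatrix 0 1 0 := by
    simp [ketPIbraPI, blochMatrix]
  have h5 : ketMIbraMI = blochMatrix 0 (-1) 0 := by
    simp [ketMIbraMI, blochMatrix]
  rw [stabStates, h0, h1, h2, h3, h4, h5]

theorem exists_blochMatrix_of_mem_stabStates {ψ : Matrix (Fin 2) (Fin 2) ℂ}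
    (hψ : ψ ∈ stabStates) :
    ∃ x y z : ℝ, ψ = blochMatrix x y z ∧
      ((x = 0 ∧ y = 0 ∧ (z = 1 ∨ z = -1)) ∨ (y = 0 ∧ z = 0 ∧ (x = 1 ∨ x = -1)) ∨
        (x = 0 ∧ z = 0 ∧ (y = 1 ∨ y = -1))) := by
  rw [stabStates_eq_blochMatrix] at hψ
  rcases hψ with h | h | h | h | h | h <;> exact ⟨_, _, _, h, by norm_num⟩

theorem trace_mul_le_of_mem_stabStates {ψ ψ1 ψ2 ψ3 : Matrix (Fin 2) (Fin 2) ℂ}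
    (hψ : ψ ∈ stabStates) (hψ1 : ψ1 ∈ stabStates) (hψ2 : ψ2 ∈ stabStates) (hψ3 : ψ3 ∈ stabStates)
    (h12 : (ψ1 * ψ2).trace = 1 / 2) (h13 : (ψ1 * ψ3).trace = 1 / 2)
    (h23 : (ψ2 * ψ3).trace = 1 / 2) :
    (ψ * ψ1).trace.re ≤ (ψ * ψ2).trace.re + (ψ * ψ3).trace.re := by
  obtain ⟨x, y, z, rfl, h⟩ := exists_blochMatrix_of_mem_stabStates hψ
  obtain ⟨x1, y1, z1, rfl, h1⟩ := exists_blochMatrix_of_mem_stabStates hψ1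
  obtain ⟨x2, y2, z2, rfl, h2⟩ := exists_blochMatrix_of_mem_stabStates hψ2
  obtain ⟨x3, y3, z3, rfl, h3⟩ := exists_blochMatrix_of_mem_stabStates hψ3
  have half : (1 / 2 : ℂ) = ((1 / 2 : ℝ) : ℂ) := by norm_num
  simp only [trace_blochMatrix_mul, half, Complex.ofReal_inj, Complex.ofReal_re] at h12 h13 h23 ⊢
  rcases h1 with ⟨rfl, rfl, rfl | rfl⟩ | ⟨rfl, rfl, rfl | rfl⟩ | ⟨rfl, rfl, rfl | rfl⟩ <;>
  rcases h2 with ⟨rfl, rfl, rfl | rfl⟩ | ⟨rfl, rfl, rfl | rfl⟩ | ⟨rfl, rfl, rfl | rfl⟩ <;>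
  first
  | (exfalso; linarith)
  | rcases h3 with ⟨rfl, rfl, rfl | rfl⟩ | ⟨rfl, rfl, rfl | rfl⟩ | ⟨rfl, rfl, rfl | rfl⟩ <;>
    first
    | (exfalso; linarith)
    | rcases h with ⟨rfl, rfl, rfl | rfl⟩ | ⟨rfl, rfl, rfl | rfl⟩ | ⟨rfl, rfl, rfl | rfl⟩ <;>
      linarith

theorem trace_mul_le_of_mem_convexHull {s : Set (Matrix (Fin 2) (Fin 2) ℂ)}
    {ρ ψ1 ψ2 ψ3 : Matrix (Fin 2) (Fin 2) ℂ} (hρ : ρ ∈ convexHull ℝ s)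
    (h : ∀ ψ ∈ s, (ψ * ψ1).trace.re ≤ (ψ * ψ2).trace.re + (ψ * ψ3).trace.re) :
    (ρ * ψ1).trace.re ≤ (ρ * ψ2).trace.re + (ρ * ψ3).trace.re := by
  suffices hconv : Convex ℝ {M : Matrix (Fin 2) (Fin 2) ℂ |
      (M * ψ1).trace.re ≤ (M * ψ2).trace.re + (M * ψ3).trace.re} from
    convexHull_min (fun ψ hψ => h ψ hψ) hconv hρ
  intro M hM N hN a b ha hb _
  simp only [Set.mem_ofPred_eq, add_mul, smul_mul_assoc, trace_add, trace_smul, Complex.add_re,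
    Complex.smul_re, smul_eq_mul] at hM hN ⊢
  nlinarith [mul_le_mul_of_nonneg_left hM ha, mul_le_mul_of_nonneg_left hN hb]

theorem blochMatrix_mem_convexHull_stabStates {x y z : ℝ} (h : |x| + |y| + |z| ≤ 1) :
    blochMatrix x y z ∈ convexHull ℝ stabStates := by
  set r := (1 - |x| - |y| - |z|) / 6 with hr
  have hr0 : 0 ≤ r := by rw [hr]; linarith
  have hx := abs_le.1 (le_refl |x|)
  have hy := abs_le.1 (le_refl |y|)
  have hz := abs_le.1 (le_refl |z|)
  let w : Fin 6 → ℝ := ![(|z| + z) / 2 + r, (|z| - z) / 2 + r, (|x| + x) / 2 + r,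
    (|x| - x) / 2 + r, (|y| + y) / 2 + r, (|y| - y) / 2 + r]
  let v : Fin 6 → Matrix (Fin 2) (Fin 2) ℂ := ![blochMatrix 0 0 1, blochMatrix 0 0 (-1),
    blochMatrix 1 0 0, blochMatrix (-1) 0 0, blochMatrix 0 1 0, blochMatrix 0 (-1) 0]
  have hw : ∀ i ∈ Finset.univ, 0 ≤ w i := by
    intro i _
    fin_cases i <;> simp [w] <;> linarith
  have hsum : ∑ i, w i = 1 := by
    simp [w, Fin.sum_univ_succ]; linarith
  have hv : ∀ i ∈ Finset.univ, v i ∈ convexHull ℝ stabStates := by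
    intro i _
    apply subset_convexHull
    rw [stabStates_eq_blochMatrix]
    fin_cases i <;> simp [v]
  have key := (convex_convexHull ℝ stabStates).sum_mem hw hsum hv
  convert key using 1
  ext i j
  fin_cases i <;> fin_cases j <;> apply Complex.ext <;>
    simp [w, v, Fin.sum_univ_succ, blochMatrix] <;> linarith

/-- **Triangle Criterion for one qubit.** A single-qubit density matrix `ρ` fails to be a
mixture of the six stabilizer pure states iff there exist three stabilizer pure states
`ψ1, ψ2, ψ3` with pairwise overlap `Tr(ψi ψj) = 1/2` such that
`Tr(ρ ψ1) > Tr(ρ ψ2) + Tr(ρ ψ3)`. -/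
theorem triangle_criterion_single_qubit (ρ : Matrix (Fin 2) (Fin 2) ℂ)
    (hρ : ρ.PosSemidef) (htr : ρ.trace = 1) :
    ρ ∉ convexHull ℝ stabStates ↔
      ∃ ψ1 ∈ stabStates, ∃ ψ2 ∈ stabStates, ∃ ψ3 ∈ stabStates,
        (ψ1 * ψ2).trace = 1/2 ∧ (ψ1 * ψ3).trace = 1/2 ∧ (ψ2 * ψ3).trace = 1/2 ∧
        (ρ * ψ2).trace.re + (ρ * ψ3).trace.re < (ρ * ψ1).trace.re := by
  constructor
  · intro hmem
    obtain ⟨x, y, z, rfl⟩ := hρ.isHermitian.exists_eq_blochMatrix htr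
    have hlt : 1 < |x| + |y| + |z| := by
      by_contra hle
      exact hmem (blochMatrix_mem_convexHull_stabStates (not_lt.1 hle))
    obtain ⟨a, ha, hax⟩ : ∃ a : ℝ, (a = 1 ∨ a = -1) ∧ x * a = |x| := by
      rcases abs_cases x with h | h
      · exact ⟨1, by simp, by linarith⟩
      · exact ⟨-1, by simp, by linarith⟩
    obtain ⟨b, hb, hby⟩ : ∃ b : ℝ, (b = 1 ∨ b = -1) ∧ y * b = -|y| := by
      rcases abs_cases y with h | h
      · exact ⟨-1, by simp, by linarith⟩
      · exact ⟨1, by simp, by linarith⟩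
    obtain ⟨c, hc, hcz⟩ : ∃ c : ℝ, (c = 1 ∨ c = -1) ∧ z * c = -|z| := by
      rcases abs_cases z with h | h
      · exact ⟨-1, by simp, by linarith⟩
      · exact ⟨1, by simp, by linarith⟩
    refine ⟨blochMatrix a 0 0, ?_, blochMatrix 0 b 0, ?_, blochMatrix 0 0 c, ?_, ?_, ?_, ?_, ?_⟩
    · rw [stabStates_eq_blochMatrix]
      rcases ha with rfl | rfl <;> simp
    · rw [stabStates_eq_blochMatrix]
      rcases hb with rfl | rfl <;> simp
    · rw [stabStates_eq_blochMatrix]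
      rcases hc with rfl | rfl <;> simp
    · simp [trace_blochMatrix_mul]
    · simp [trace_blochMatrix_mul]
    · simp [trace_blochMatrix_mul]
    · simp only [trace_blochMatrix_mul, Complex.ofReal_re]
      linarith
  · rintro ⟨ψ1, h1, ψ2, h2, ψ3, h3, h12, h13, h23, hlt⟩ hmem
    exact not_le.2 hlt (trace_mul_le_of_mem_convexHull hmem fun ψ hψ =>
      trace_mul_le_of_mem_stabStates hψ h1 h2 h3 h12 h13 h23)
end

section
/- Let W = |+⟩⟨+| + |+i⟩⟨+i| − |0⟩⟨0| as a 2×2 complex matrix. Then Tr(Wτ) ≥ 0 for every τ in the convex hull of the six single-qubit stabilizer pure states, while the minimum of Tr(Wρ) over all 2×2 density matrices ρ equals (1 − √3)/2 < 0. In particular, W is a magic witness: it is nonnegative on all single-qubit stabilizer states but negative on some single-qubit state. -/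
open Matrix
open scoped ComplexOrder

theorem trace_re_witness_mul (τ : Matrix (Fin 2) (Fin 2) ℂ) :
    ((ketPbraP + ketPIbraPI - ket0bra0) * τ).trace.re =
      ((τ 0 1).re - (τ 0 1).im + (τ 1 0).re + (τ 1 0).im) / 2 + (τ 1 1).re := by
  simp only [Matrix.trace_fin_two, Matrix.mul_apply, Fin.sum_univ_two]
  simp [ketPbraP, ketPIbraPI, ket0bra0]
  ring

theorem convex_setOf_trace_mul_re_nonneg (W : Matrix (Fin 2) (Fin 2) ℂ) :
    Convex ℝ {τ : Matrix (Fin 2) (Fin 2) ℂ | 0 ≤ (W * τ).trace.re} := by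
  intro x hx y hy a b ha hb _
  simp only [Set.mem_ofPred_eq] at *
  simp only [Matrix.mul_add, Matrix.mul_smul, Matrix.trace_add, Matrix.trace_smul,
    Complex.add_re, Complex.smul_re, smul_eq_mul]
  positivity

theorem witness_nonneg_of_mem_stabStates {τ : Matrix (Fin 2) (Fin 2) ℂ} (hτ : τ ∈ stabStates) :
    0 ≤ ((ketPbraP + ketPIbraPI - ket0bra0) * τ).trace.re := by
  rw [trace_re_witness_mul]
  rcases hτ with rfl | rfl | rfl | rfl | rfl | rfl <;>
    norm_num [ket0bra0, ket1bra1, ketPbraP, ketMbraM, ketPIbraPI, ketMIbraMI]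

theorem witness_lower_bound {ρ : Matrix (Fin 2) (Fin 2) ℂ} (hρ : ρ.PosSemidef)
    (htr : ρ.trace = 1) :
    (1 - Real.sqrt 3) / 2 ≤ ((ketPbraP + ketPIbraPI - ket0bra0) * ρ).trace.re := by
  rw [trace_re_witness_mul]
  have h10 : ρ 1 0 = star (ρ 0 1) := (hρ.isHermitian.apply 1 0).symm
  have h00 : (ρ 0 0).im = 0 := Complex.conj_eq_iff_im.1 (hρ.isHermitian.apply 0 0)
  have hdet := (Complex.le_def.1 hρ.det_nonneg).1
  have htr' := congrArg Complex.re htr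
  rw [Matrix.det_fin_two, h10] at hdet
  simp [Matrix.trace, Fin.sum_univ_two, h00] at hdet htr'
  rw [h10]
  simp only [Complex.star_def, Complex.conj_re, Complex.conj_im]
  have ha : (ρ 0 0).re = 1 - (ρ 1 1).re := by linarith
  rw [ha] at hdet
  generalize (ρ 0 1).re = x at *
  generalize (ρ 0 1).im = y at *
  generalize (ρ 1 1).re = d at *
  have hsq : (x - y + (d - 1 / 2)) ^ 2 ≤ (Real.sqrt 3 / 2) ^ 2 := by
    rw [div_pow, Real.sq_sqrt (by norm_num)]
    nlinarith [sq_nonneg (x + y), sq_nonneg (x - (d - 1 / 2)), sq_nonneg (y + (d - 1 / 2))]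
  have := (abs_le_of_sq_le_sq' hsq (by positivity)).1
  linarith

/-- The pure state with Bloch vector `s • (-1, -1, 1)`, when `3 * s ^ 2 = 1`. -/
noncomputable def diagonalState (s : ℝ) : Matrix (Fin 2) (Fin 2) ℂ :=
  !![(1 + s) / 2, (-1 + Complex.I) * s / 2; (-1 - Complex.I) * s / 2, (1 - s) / 2]

theorem diagonalState_posSemidef {s : ℝ} (hs : 3 * s ^ 2 = 1) :
    (diagonalState s).PosSemidef := by
  have hs' : 3 * (s : ℂ) ^ 2 = 1 := by exact_mod_cast hs
  have h2 : (starRingEnd ℂ) 2 = 2 := Complex.conj_ofNat 2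
  have h : diagonalState s = (diagonalState s)ᴴ * diagonalState s := by
    ext i j
    fin_cases i <;> fin_cases j <;>
      simp [diagonalState, Matrix.mul_apply, Fin.sum_univ_two, h2] <;>
      grind [Complex.I_sq]
  rw [h]
  exact Matrix.posSemidef_conjTranspose_mul_self _

/-- The witness `W = |+⟩⟨+| + |+i⟩⟨+i| − |0⟩⟨0|` is nonnegative on all single-qubit
stabilizer (mixed) states, while its minimum over all 2×2 density matrices equals
`(1 − √3)/2 < 0`; hence it is a magic witness. -/
theorem magic_witness_W (W : Matrix (Fin 2) (Fin 2) ℂ)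
    (hW : W = ketPbraP + ketPIbraPI - ket0bra0) :
    (∀ τ ∈ convexHull ℝ stabStates, 0 ≤ (W * τ).trace.re) ∧
    IsLeast {x : ℝ | ∃ ρ : Matrix (Fin 2) (Fin 2) ℂ,
        ρ.PosSemidef ∧ ρ.trace = 1 ∧ x = (W * ρ).trace.re} ((1 - Real.sqrt 3) / 2) ∧
    (1 - Real.sqrt 3) / 2 < 0 := by
  subst hW
  have h3 : Real.sqrt 3 ^ 2 = 3 := Real.sq_sqrt (by norm_num)
  refine ⟨fun τ hτ => ?_, ⟨⟨diagonalState (Real.sqrt 3 / 3), ?_, ?_, ?_⟩, ?_⟩, ?_⟩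
  · exact convexHull_min (fun _ => witness_nonneg_of_mem_stabStates)
      (convex_setOf_trace_mul_re_nonneg _) hτ
  · exact diagonalState_posSemidef (by rw [div_pow, h3]; norm_num)
  · simp [diagonalState, Matrix.trace, Fin.sum_univ_two]
    ring
  · rw [trace_re_witness_mul]
    generalize Real.sqrt 3 = r
    have hr : diagonalState (r / 3) 1 1 = ((1 - r / 3) / 2 : ℝ) := by simp [diagonalState]
    rw [hr, Complex.ofReal_re]
    simp [diagonalState]
    ring
  · rintro x ⟨ρ, hρ, htr, rfl⟩
    exact witness_lower_bound hρ htr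
  · have : 1 < Real.sqrt 3 := Real.lt_sqrt_of_sq_lt (by norm_num)
    linarith
end

section
/- Let A = |0⟩⟨0| + |+⟩⟨+| + |+i⟩⟨+i| as a 2×2 complex matrix. Then for every τ in the convex hull of the six single-qubit stabilizer pure states, Tr(Aτ) ≤ 2, with equality attained for τ = |0⟩⟨0|, |+⟩⟨+|, and |+i⟩⟨+i|. -/
open Matrix
open scoped ComplexOrder

/-- For `A = |0⟩⟨0| + |+⟩⟨+| + |+i⟩⟨+i|`, every state `τ` in the stabilizer octahedron
satisfies `Tr(Aτ) ≤ 2`, with equality attained at `|0⟩⟨0|`, `|+⟩⟨+|` and `|+i⟩⟨+i|`. -/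
theorem stabilizer_bound_A (A : Matrix (Fin 2) (Fin 2) ℂ)
    (hA : A = ket0bra0 + ketPbraP + ketPIbraPI) :
    (∀ τ ∈ convexHull ℝ stabStates, (A * τ).trace.re ≤ 2) ∧
    (A * ket0bra0).trace = 2 ∧ (A * ketPbraP).trace = 2 ∧ (A * ketPIbraPI).trace = 2 := by
  subst hA
  refine ⟨fun τ hτ => ?_, ?_, ?_, ?_⟩
  · set A := ket0bra0 + ketPbraP + ketPIbraPI with hA
    refine convexHull_min (t := {τ | (A * τ).trace.re ≤ 2}) ?_ ?_ hτ
    · intro σ hσ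
      simp only [stabStates, Set.mem_insert_iff, Set.mem_singleton_iff] at hσ
      rcases hσ with rfl | rfl | rfl | rfl | rfl | rfl <;>
        norm_num [hA, ket0bra0, ket1bra1, ketPbraP, ketMbraM, ketPIbraPI, ketMIbraMI,
          Matrix.trace_fin_two]
    · exact convex_halfSpace_le
        { map_add := fun x y => by simp [Matrix.mul_add]
          map_smul := fun c x => by simp } 2
  all_goals
    norm_num [ket0bra0, ketPbraP, ketPIbraPI, Matrix.trace_fin_two, Complex.ext_iff]
end

section
/- Let d_A ≥ 1, d_B ≥ 1 be integers, d = d_A·d_B, and let c be a real number with 0 ≤ c ≤ d_A − 1. Let ρ be a density matrix on ℂ^{d_A} ⊗ ℂ^{d_B} with purity Tr(ρ²) ≤ 1/(d − c). Then for every d×d unitary U and every unit vector v ∈ ℂ^{d_B}, the conditional matrix M = (I_{d_A} ⊗ ⟨v|) U ρ U† (I_{d_A} ⊗ |v⟩), i.e. the matrix with entries M_{jk} = Σ_{a,b} v̄_a (UρU†)_{(j,a),(k,b)} v_b, satisfies Tr(M²) ≤ (Tr M)²/(d_A − c). In other words, after an arbitrary unitary on AB and an arbitrary rank-one measurement with post-selection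 on B, the purity of the (normalized) reduced state on A is at most 1/(d_A − c). -/
open Matrix
open scoped ComplexOrder

/-- Compressing a Hermitian matrix by an isometry `V` decreases the Hilbert–Schmidt norm; the
remainder is bounded below using the complementary projection `1 - V * Vᴴ`. -/
lemma trace_sq_compression_le {m n : Type*} [Fintype m] [Fintype n] [DecidableEq m]
    [DecidableEq n] (S : Matrix n n ℂ) (hS : S.IsHermitian) (V : Matrix n m ℂ)
    (hV : Vᴴ * V = 1) (t : ℝ) :
    ((Vᴴ * S * V) * (Vᴴ * S * V)).trace.re ≤ (S * S).trace.re
      + t ^ 2 * ((Fintype.card n : ℝ) - Fintype.card m)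
      - 2 * t * (S.trace.re - (Vᴴ * S * V).trace.re) := by
  obtain ⟨M, hM⟩ : ∃ M, M = Vᴴ * S * V := ⟨_, rfl⟩
  obtain ⟨B, hB⟩ : ∃ B, B = V * M * Vᴴ := ⟨_, rfl⟩
  obtain ⟨C, hC⟩ : ∃ C, C = 1 - V * Vᴴ := ⟨_, rfl⟩
  have hMh : Mᴴ = M := by simp [hM, hS.eq, Matrix.mul_assoc]
  have hBh : Bᴴ = B := by simp [hB, hMh, Matrix.mul_assoc]
  have hCh : Cᴴ = C := by simp [hC]
  have hCV : C * V = 0 := by rw [hC, Matrix.sub_mul, Matrix.mul_assoc, hV]; simp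
  have hVC : Vᴴ * C = 0 := by rw [hC, Matrix.mul_sub, ← Matrix.mul_assoc, hV]; simp
  have hCC : C * C = C := by
    nth_rw 2 [hC]
    rw [Matrix.mul_sub, ← Matrix.mul_assoc, hCV]; simp
  have hBC : B * C = 0 := by rw [hB, Matrix.mul_assoc, hVC, Matrix.mul_zero]
  have hCB : C * B = 0 := by
    rw [hB, ← Matrix.mul_assoc, ← Matrix.mul_assoc, hCV, Matrix.zero_mul, Matrix.zero_mul]
  have hBB : (B * B).trace = (M * M).trace := by
    have h : B * B = V * (M * M * Vᴴ) := by
      calc B * B = V * M * (Vᴴ * V) * M * Vᴴ := by simp only [hB, Matrix.mul_assoc]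
        _ = V * (M * M * Vᴴ) := by simp only [hV, Matrix.mul_one, Matrix.mul_assoc]
    rw [h, Matrix.trace_mul_comm, Matrix.mul_assoc, hV, Matrix.mul_one]
  have hSB : (S * B).trace = (M * M).trace := by
    rw [hB, ← Matrix.mul_assoc, Matrix.trace_mul_comm, ← Matrix.mul_assoc, ← Matrix.mul_assoc,
      ← hM]
  have hSC : (S * C).trace = S.trace - M.trace := by
    rw [hC, Matrix.mul_sub, Matrix.trace_sub, Matrix.mul_one, ← Matrix.mul_assoc,
      Matrix.trace_mul_comm, ← Matrix.mul_assoc, ← hM]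
  have hCtr : C.trace = (Fintype.card n : ℂ) - Fintype.card m := by
    rw [hC, Matrix.trace_sub, Matrix.trace_mul_comm, hV, Matrix.trace_one, Matrix.trace_one]
  have key : 0 ≤ ((S - B - (t : ℂ) • C)ᴴ * (S - B - (t : ℂ) • C)).trace :=
    (Matrix.posSemidef_conjTranspose_mul_self _).trace_nonneg
  have expand : ((S - B - (t : ℂ) • C)ᴴ * (S - B - (t : ℂ) • C)).trace
      = (S * S).trace - (M * M).trace + (t : ℂ) ^ 2 * ((Fintype.card n : ℂ) - Fintype.card m)
        - 2 * (t : ℂ) * (S.trace - M.trace) := by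
    simp only [Matrix.conjTranspose_sub, Matrix.conjTranspose_smul, hS.eq, hBh, hCh,
      Complex.star_def, Complex.conj_ofReal, Matrix.sub_mul, Matrix.mul_sub, Matrix.smul_mul,
      Matrix.mul_smul, hBC, hCB, hCC, Matrix.trace_sub, Matrix.trace_smul, hBB, hSB, hSC, hCtr,
      Matrix.trace_mul_comm B S, Matrix.trace_mul_comm C S, smul_eq_mul, Matrix.trace_zero]
    ring
  rw [expand] at key
  have hre := (Complex.le_def.1 key).1
  rw [← Complex.ofReal_pow] at hre
  simp only [Complex.zero_re, Complex.add_re, Complex.sub_re, Complex.ofReal_re, Complex.ofReal_im,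
    Complex.natCast_re, mul_assoc, Complex.mul_re, Complex.re_ofNat, Complex.im_ofNat, zero_mul,
    sub_zero] at hre
  rw [← hM]
  linarith

/-- **Purity reduction under unitaries and post-selection.** If a bipartite density matrix
`ρ` on `ℂ^{dA} ⊗ ℂ^{dB}` has purity at most `1/(dA·dB − c)` with `0 ≤ c ≤ dA − 1`, then for
any unitary `U` and any unit vector `v` on the `B` system, the conditional matrix
`M = (I ⊗ ⟨v|) UρU† (I ⊗ |v⟩)` satisfies `Tr(M²) ≤ (Tr M)² / (dA − c)`. -/
theorem purity_reduction (dA dB : ℕ) (hA : 1 ≤ dA) (hB : 1 ≤ dB) (c : ℝ)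
    (hc0 : 0 ≤ c) (hc1 : c ≤ (dA : ℝ) - 1)
    (ρ : Matrix (Fin dA × Fin dB) (Fin dA × Fin dB) ℂ)
    (hρ : ρ.PosSemidef) (htr : ρ.trace = 1)
    (hpur : (ρ * ρ).trace.re ≤ 1 / ((dA : ℝ) * dB - c))
    (U : Matrix (Fin dA × Fin dB) (Fin dA × Fin dB) ℂ)
    (hU : U ∈ Matrix.unitaryGroup (Fin dA × Fin dB) ℂ)
    (v : Fin dB → ℂ) (hv : ∑ a, Complex.normSq (v a) = 1)
    (M : Matrix (Fin dA) (Fin dA) ℂ)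
    (hM : M = Matrix.of fun j k =>
      ∑ a, ∑ b, (starRingEnd ℂ) (v a) * (U * ρ * Uᴴ) (j, a) (k, b) * v b) :
    (M * M).trace.re ≤ (M.trace.re) ^ 2 / ((dA : ℝ) - c) := by
  let V : Matrix (Fin dA × Fin dB) (Fin dA) ℂ := Matrix.of fun p k => if p.1 = k then v p.2 else 0
  have hV : Vᴴ * V = 1 := by
    have hv' : ∑ a, (starRingEnd ℂ) (v a) * v a = 1 := by
      simp only [← Complex.normSq_eq_conj_mul_self]
      exact_mod_cast hv
    ext j k
    simp only [V, Matrix.mul_apply, Matrix.conjTranspose_apply, Matrix.of_apply,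
      Fintype.sum_prod_type, Matrix.one_apply]
    rw [Finset.sum_eq_single j (by intro i _ hi; simp [hi]) (by simp)]
    by_cases hjk : j = k
    · simpa [hjk] using hv'
    · simp [hjk]
  have hMV : M = Vᴴ * (U * ρ * Uᴴ) * V := by
    rw [hM]
    generalize U * ρ * Uᴴ = S
    ext j k
    simp only [V, Matrix.mul_apply, Matrix.conjTranspose_apply, Matrix.of_apply,
      Fintype.sum_prod_type]
    rw [Finset.sum_eq_single k (by intro i _ hi; simp [hi]) (by simp), Finset.sum_comm]
    refine Finset.sum_congr rfl fun b _ => ?_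
    rw [Finset.sum_eq_single j (by intro i _ hi; simp [hi]) (by simp)]
    simp [Finset.sum_mul]
  have hUU : Uᴴ * U = 1 := Matrix.mem_unitaryGroup_iff'.1 hU
  have hS : (U * ρ * Uᴴ).IsHermitian := Matrix.isHermitian_mul_mul_conjTranspose U hρ.isHermitian
  have hStr : (U * ρ * Uᴴ).trace = 1 := by
    rw [Matrix.trace_mul_comm, ← Matrix.mul_assoc, hUU, Matrix.one_mul, htr]
  have hSS : ((U * ρ * Uᴴ) * (U * ρ * Uᴴ)).trace = (ρ * ρ).trace := by
    have h : (U * ρ * Uᴴ) * (U * ρ * Uᴴ) = U * (ρ * ρ * Uᴴ) := by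
      calc (U * ρ * Uᴴ) * (U * ρ * Uᴴ) = U * ρ * (Uᴴ * U) * ρ * Uᴴ := by
            simp only [Matrix.mul_assoc]
        _ = U * (ρ * ρ * Uᴴ) := by simp only [hUU, Matrix.mul_one, Matrix.mul_assoc]
    rw [h, Matrix.trace_mul_comm, Matrix.mul_assoc, hUU, Matrix.mul_one]
  have hA' : (1 : ℝ) ≤ dA := by exact_mod_cast hA
  have hB' : (1 : ℝ) ≤ dB := by exact_mod_cast hB
  have hm : 0 < (dA : ℝ) - c := by linarith
  have hD : 0 < (dA : ℝ) * dB - c := by nlinarith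
  have hmain := trace_sq_compression_le _ hS V hV (1 / ((dA : ℝ) * dB - c))
  rw [← hMV, hStr, hSS] at hmain
  simp only [Fintype.card_prod, Fintype.card_fin, Nat.cast_mul, Complex.one_re] at hmain
  refine (hmain.trans ?_)
  have hsq : 0 ≤ ((dA : ℝ) - c) * (M.trace.re / (dA - c) - 1 / (dA * dB - c)) ^ 2 := by positivity
  have hid : M.trace.re ^ 2 / ((dA : ℝ) - c)
      - (1 / ((dA : ℝ) * dB - c) + (1 / ((dA : ℝ) * dB - c)) ^ 2 * ((dA : ℝ) * dB - dA)
        - 2 * (1 / ((dA : ℝ) * dB - c)) * (1 - M.trace.re))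
      = ((dA : ℝ) - c) * (M.trace.re / (dA - c) - 1 / (dA * dB - c)) ^ 2 := by
    field_simp
    ring
  linarith
end

section
/- Let d_A ≥ 1, d_B ≥ 2 be integers, d = d_A·d_B, and let c be a real number with 0 ≤ c ≤ d_A − 1. Then there exist a density matrix M on ℂ^{d_A} ⊗ ℂ^{d_B} with Tr(M²) = 1/(d − c) and a unit vector v ∈ ℂ^{d_B} such that the conditional matrix M_A = (I_{d_A} ⊗ ⟨v|) M (I_{d_A} ⊗ |v⟩) satisfies Tr(M_A) > 0 and Tr(M_A²) = (Tr M_A)²/(d_A − c). That is, the purity bound 1/(d_A − c) for the post-selected reduced state is achieved. -/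
open Matrix
open scoped ComplexOrder

/-- Every `x ∈ [1, n + 1]` is both the sum and the sum of squares of some `n + 1` nonnegative
reals. -/
theorem exists_nonneg_sum_eq_sum_sq_eq (n : ℕ) (x : ℝ) (h1 : 1 ≤ x) (hn : x ≤ n + 1) :
    ∃ q : Fin (n + 1) → ℝ, (∀ j, 0 ≤ q j) ∧ ∑ j, q j = x ∧ ∑ j, q j ^ 2 = x := by
  have hx : 0 < x := by linarith
  have hn0 : (0 : ℝ) ≤ n := n.cast_nonneg
  obtain ⟨s, hs0, hs1, hs⟩ : ∃ s : ℝ, 0 ≤ s ∧ s ≤ 1 ∧ s ^ 2 * (x * n) = n + 1 - x := by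
    rcases hn0.eq_or_lt with h | h
    · exact ⟨0, le_rfl, zero_le_one, by rw [← h] at hn ⊢; linarith⟩
    · refine ⟨√((n + 1 - x) / (x * n)), Real.sqrt_nonneg _, ?_, ?_⟩
      · refine Real.sqrt_le_iff.2 ⟨zero_le_one, ?_⟩
        rw [one_pow, div_le_one (by positivity)]
        nlinarith
      · rw [Real.sq_sqrt (div_nonneg (by linarith) (by positivity))]
        field_simp
  have hpos : (0 : ℝ) < n + 1 := by positivity
  have hb : 0 ≤ x * ((1 - s) / (n + 1)) :=
    mul_nonneg hx.le (div_nonneg (by linarith) hpos.le)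
  refine ⟨Fin.cons (x * ((1 - s) / (n + 1) + s)) fun _ => x * ((1 - s) / (n + 1)), ?_, ?_, ?_⟩
  · refine Fin.cases ?_ fun j => ?_
    · simp only [Fin.cons_zero, mul_add]
      positivity
    · simpa using hb
  · simp only [Fin.sum_univ_succ, Fin.cons_zero, Fin.cons_succ, Finset.sum_const,
      Finset.card_univ, Fintype.card_fin, nsmul_eq_mul]
    field_simp
    ring
  · simp only [Fin.sum_univ_succ, Fin.cons_zero, Fin.cons_succ, Finset.sum_const,
      Finset.card_univ, Fintype.card_fin, nsmul_eq_mul]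
    field_simp
    linear_combination (n + 1) * hs

/-- The purity of a real diagonal matrix is the sum of the squares of its entries. -/
theorem re_trace_diagonal_ofReal_mul_self {ι : Type*} [Fintype ι] [DecidableEq ι] (f : ι → ℝ) :
    ((diagonal fun i => (f i : ℂ)) * diagonal fun i => (f i : ℂ)).trace.re = ∑ i, f i ^ 2 := by
  simp only [diagonal_mul_diagonal, trace_diagonal, ← Complex.ofReal_mul, ← Complex.ofReal_sum,
    Complex.ofReal_re, pow_two]

/-- **Tightness of the purity-reduction bound.** For `dA ≥ 1`, `dB ≥ 2`, `d = dA·dB` and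
`0 ≤ c ≤ dA − 1`, there exist a density matrix `M` on `ℂ^{dA} ⊗ ℂ^{dB}` of purity
`1/(d − c)` and a unit vector `v` on `B` such that the post-selected conditional matrix
`M_A = (I ⊗ ⟨v|) M (I ⊗ |v⟩)` has `Tr M_A > 0` and `Tr(M_A²) = (Tr M_A)²/(dA − c)`. -/
theorem purity_reduction_tight (dA dB : ℕ) (hA : 1 ≤ dA) (hB : 2 ≤ dB) (c : ℝ)
    (hc0 : 0 ≤ c) (hc1 : c ≤ (dA : ℝ) - 1) :
    ∃ (M : Matrix (Fin dA × Fin dB) (Fin dA × Fin dB) ℂ) (v : Fin dB → ℂ)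
      (MA : Matrix (Fin dA) (Fin dA) ℂ),
      M.PosSemidef ∧ M.trace = 1 ∧
      (M * M).trace.re = 1 / ((dA : ℝ) * dB - c) ∧
      (∑ a, Complex.normSq (v a) = 1) ∧
      MA = (Matrix.of fun j k =>
        ∑ a, ∑ b, (starRingEnd ℂ) (v a) * M (j, a) (k, b) * v b) ∧
      0 < MA.trace.re ∧
      (MA * MA).trace.re = (MA.trace.re) ^ 2 / ((dA : ℝ) - c) := by
  obtain ⟨n, rfl⟩ : ∃ n, dA = n + 1 := ⟨dA - 1, by omega⟩
  obtain ⟨m, rfl⟩ : ∃ m, dB = m + 1 := ⟨dB - 1, by omega⟩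
  rw [Nat.cast_add_one] at hc1
  rw [Nat.cast_add_one, Nat.cast_add_one]
  obtain ⟨q, hq0, hq1, hq2⟩ :=
    exists_nonneg_sum_eq_sum_sq_eq n (n + 1 - c) (by linarith) (by linarith)
  set D : ℝ := (n + 1) * (m + 1) - c with hD
  have hDpos : 0 < D := by
    have : (0 : ℝ) ≤ (n + 1) * m := by positivity
    linarith
  have hx : 0 < (n : ℝ) + 1 - c := by linarith
  let f : Fin (n + 1) × Fin (m + 1) → ℝ :=
    fun p => Fin.cons (α := fun _ => ℝ) (q p.1 / D) (fun _ => 1 / D) p.2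
  have hf0 : ∀ p, 0 ≤ f p := by
    rintro ⟨j, a⟩
    refine Fin.cases ?_ (fun a => ?_) a
    · exact div_nonneg (hq0 j) hDpos.le
    · exact (one_div_pos.2 hDpos).le
  have hf1 : ∑ p, f p = 1 := by
    simp only [f, Fintype.sum_prod_type, Fin.sum_univ_succ (n := m), Fin.cons_zero,
      Fin.cons_succ, Finset.sum_add_distrib, ← Finset.sum_div, hq1, Finset.sum_const,
      Finset.card_univ, Fintype.card_fin, nsmul_eq_mul]
    push_cast
    field_simp
    rw [hD]
    ring
  have hf2 : ∑ p, f p ^ 2 = 1 / D := by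
    simp only [f, Fintype.sum_prod_type, Fin.sum_univ_succ (n := m), Fin.cons_zero,
      Fin.cons_succ, Finset.sum_add_distrib, div_pow, ← Finset.sum_div, hq2, Finset.sum_const,
      Finset.card_univ, Fintype.card_fin, nsmul_eq_mul]
    push_cast
    field_simp
    rw [hD]
    ring
  have hMA : (Matrix.of fun j k =>
      ∑ a, ∑ b, (starRingEnd ℂ) ((Pi.single 0 1 : Fin (m + 1) → ℂ) a) *
        diagonal (fun p => (f p : ℂ)) (j, a) (k, b) * (Pi.single 0 1 : Fin (m + 1) → ℂ) b) =
      diagonal fun j => ((q j / D : ℝ) : ℂ) := by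
    ext j k
    by_cases h : j = k <;>
      simp [Pi.single_apply, diagonal_apply, Fin.sum_univ_succ, f, h]
  have htr : (diagonal fun j => ((q j / D : ℝ) : ℂ)).trace.re = (n + 1 - c) / D := by
    rw [trace_diagonal, ← Complex.ofReal_sum, Complex.ofReal_re, ← Finset.sum_div, hq1]
  refine ⟨diagonal fun p => (f p : ℂ), Pi.single 0 1, _, ?_, ?_, ?_, ?_, hMA.symm, ?_, ?_⟩
  · exact PosSemidef.diagonal fun p => Complex.zero_le_real.2 (hf0 p)
  · rw [trace_diagonal, ← Complex.ofReal_sum, hf1, Complex.ofReal_one]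
  · rw [re_trace_diagonal_ofReal_mul_self, hf2]
  · simp [Pi.single_apply, apply_ite Complex.normSq]
  · rw [htr]
    positivity
  · rw [htr, re_trace_diagonal_ofReal_mul_self]
    simp only [div_pow, ← Finset.sum_div, hq2]
    field_simp
end

section
/- Let m ≥ 1 be an integer and d = 2m. Let A = |0⟩⟨0| + |+⟩⟨+| + |+i⟩⟨+i| as a 2×2 matrix, let E be the m×m projector onto the first standard basis vector of ℂ^m, and define ρ = (1/(d − 1/2)) I_d + (1/(2(d − 1/2))) (A − 2 I_2) ⊗ E on ℂ² ⊗ ℂ^m. Then ρ is a positive definite matrix with Tr ρ = 1 and purity Tr(ρ²) = 1/(d − 1/2). -/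
open Matrix
open scoped ComplexOrder Kronecker

/-- `A = |0⟩⟨0| + |+⟩⟨+| + |+i⟩⟨+i|`. -/
noncomputable def matA : Matrix (Fin 2) (Fin 2) ℂ := ket0bra0 + ketPbraP + ketPIbraPI

/-- The projector onto the first standard basis vector of `ℂ^m`. -/
noncomputable def projE (m : ℕ) : Matrix (Fin m) (Fin m) ℂ :=
  Matrix.of fun i j => if (i : ℕ) = 0 ∧ (j : ℕ) = 0 then 1 else 0

/-- The state `ρ = (1/(d−1/2)) I + (1/(2(d−1/2))) (A − 2I) ⊗ E` on `ℂ² ⊗ ℂ^m`,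
with `d = 2m`. -/
noncomputable def minPurityState (m : ℕ) : Matrix (Fin 2 × Fin m) (Fin 2 × Fin m) ℂ :=
  ((1 / (2 * (m : ℝ) - 1/2) : ℝ) : ℂ) • (1 : Matrix (Fin 2 × Fin m) (Fin 2 × Fin m) ℂ) +
  ((1 / (2 * (2 * (m : ℝ) - 1/2)) : ℝ) : ℂ) • ((matA - (2 : ℂ) • 1) ⊗ₖ projE m)

theorem projE_eq_diagonal (m : ℕ) :
    projE m = diagonal fun i : Fin m => if (i : ℕ) = 0 then (1 : ℂ) else 0 := by
  ext i j
  by_cases hij : i = j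
  · subst hij
    simp [projE]
  · have h : ¬((i : ℕ) = 0 ∧ (j : ℕ) = 0) := fun h => hij (Fin.ext (h.1.trans h.2.symm))
    simp [projE, hij, h]

theorem projE_posSemidef (m : ℕ) : (projE m).PosSemidef := by
  rw [projE_eq_diagonal]
  refine PosSemidef.diagonal fun i => ?_
  dsimp only [Pi.zero_apply]
  split_ifs <;> simp

theorem one_sub_projE_posSemidef (m : ℕ) : (1 - projE m).PosSemidef := by
  rw [projE_eq_diagonal, ← diagonal_one, diagonal_sub]
  refine PosSemidef.diagonal fun i => ?_
  dsimp only [Pi.zero_apply]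
  split_ifs <;> simp

theorem projE_mul_self (m : ℕ) : projE m * projE m = projE m := by
  simp [projE_eq_diagonal, diagonal_mul_diagonal]

theorem trace_projE {m : ℕ} (hm : 1 ≤ m) : (projE m).trace = 1 := by
  obtain ⟨n, rfl⟩ := Nat.exists_eq_add_of_le' hm
  simp [projE_eq_diagonal, trace_diagonal]

theorem matA_sub_two : matA - (2 : ℂ) • 1 =
    !![0, (1 - Complex.I) / 2; (1 + Complex.I) / 2, -1] := by
  ext i j
  fin_cases i <;> fin_cases j <;>
    simp [matA, ket0bra0, ketPbraP, ketPIbraPI] <;> ring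

theorem trace_matA_sub_two : (matA - (2 : ℂ) • 1).trace = -1 := by
  simp [matA_sub_two, trace_fin_two]

theorem trace_matA_sub_two_mul_self :
    ((matA - (2 : ℂ) • 1) * (matA - (2 : ℂ) • 1)).trace = 2 := by
  rw [matA_sub_two]
  simp only [trace_fin_two, mul_fin_two, of_apply, cons_val_zero, cons_val_one, cons_val']
  linear_combination (-1 / 2 : ℂ) * Complex.I_sq

/-- The smallest eigenvalue of `A` is at least `1/2`. -/
theorem matA_sub_half_posSemidef : (matA - (1 / 2 : ℂ) • 1).PosSemidef := by
  have h : matA - (1 / 2 : ℂ) • 1 = (1 / 2 : ℂ) •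
      (vecMulVec ![1 - Complex.I, 1] (star ![1 - Complex.I, 1]) +
        vecMulVec ![1, 0] (star ![1, 0])) := by
    ext i j
    simp only [Matrix.sub_apply, Matrix.smul_apply, Matrix.add_apply, vecMulVec_apply,
      Pi.star_apply, matA, ket0bra0, ketPbraP, ketPIbraPI]
    fin_cases i <;> fin_cases j <;> simp <;> ring_nf <;> simp <;> norm_num
  rw [h]
  exact ((posSemidef_vecMulVec_self_star _).add (posSemidef_vecMulVec_self_star _)).smul
    (by norm_num [Complex.le_def])

theorem minPurityState_eq (m : ℕ) :
    minPurityState m = ((1 / (2 * (m : ℝ) - 1/2) : ℝ) : ℂ) •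
      (1 + (1 / 2 : ℂ) • ((matA - (2 : ℂ) • 1) ⊗ₖ projE m)) := by
  rw [minPurityState, smul_add, smul_smul]
  congr 2
  push_cast
  rw [one_div, mul_inv, one_div, one_div, mul_comm]

theorem minPurityState_posDef {m : ℕ} (hm : 1 ≤ m) : (minPurityState m).PosDef := by
  have hm' : (1 : ℝ) ≤ m := by exact_mod_cast hm
  have hc : (0 : ℝ) < 1 / (2 * (m : ℝ) - 1/2) := one_div_pos.mpr (by linarith)
  have h : 1 + (1 / 2 : ℂ) • ((matA - (2 : ℂ) • 1) ⊗ₖ projE m) =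
      (1 / 4 : ℂ) • (1 : Matrix (Fin 2 × Fin m) (Fin 2 × Fin m) ℂ) +
      ((3 / 4 : ℂ) • ((1 : Matrix (Fin 2) (Fin 2) ℂ) ⊗ₖ (1 - projE m)) +
        (1 / 2 : ℂ) • ((matA - (1 / 2 : ℂ) • 1) ⊗ₖ projE m)) := by
    rw [← one_kronecker_one]
    ext ⟨i, k⟩ ⟨j, l⟩
    simp only [Matrix.add_apply, Matrix.smul_apply, Matrix.sub_apply, kronecker_apply, smul_eq_mul]
    ring
  rw [minPurityState_eq, h]
  refine PosDef.smul (PosDef.add_posSemidef (PosDef.one.smul ?_) ((PosSemidef.smul ?_ ?_).add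
    (PosSemidef.smul ?_ ?_))) ?_
  · norm_num [Complex.lt_def]
  · exact PosSemidef.one.kronecker (one_sub_projE_posSemidef m)
  · norm_num [Complex.le_def]
  · exact matA_sub_half_posSemidef.kronecker (projE_posSemidef m)
  · norm_num [Complex.le_def]
  · exact_mod_cast hc

theorem two_mul_natCast_sub_half_ne_zero {m : ℕ} (hm : 1 ≤ m) : 2 * (m : ℂ) - 1 / 2 ≠ 0 := by
  have hm' : (1 : ℝ) ≤ m := by exact_mod_cast hm
  intro h
  have hre := congrArg Complex.re h
  norm_num at hre
  linarith

theorem trace_minPurityState {m : ℕ} (hm : 1 ≤ m) : (minPurityState m).trace = 1 := by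
  have hd := two_mul_natCast_sub_half_ne_zero hm
  rw [minPurityState_eq, trace_smul, trace_add, trace_smul, trace_kronecker,
    trace_matA_sub_two, trace_projE hm, trace_one]
  simp only [Fintype.card_prod, Fintype.card_fin, smul_eq_mul]
  push_cast
  rw [one_div_mul_eq_div, div_eq_one_iff_eq hd]
  ring

theorem trace_minPurityState_mul_self {m : ℕ} (hm : 1 ≤ m) :
    (minPurityState m * minPurityState m).trace = ((1 / (2 * (m : ℝ) - 1/2) : ℝ) : ℂ) := by
  have hd := two_mul_natCast_sub_half_ne_zero hm
  rw [minPurityState_eq, smul_mul_smul_comm, add_mul, mul_add, mul_add, one_mul, one_mul, mul_one,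
    smul_mul_smul_comm, ← mul_kronecker_mul, projE_mul_self]
  simp only [trace_smul, trace_add, trace_kronecker, trace_matA_sub_two,
    trace_matA_sub_two_mul_self, trace_projE hm, trace_one, Fintype.card_prod, Fintype.card_fin,
    smul_eq_mul]
  push_cast
  have h : 2 * (m : ℂ) + 1 / 2 * (-1 * 1) + (1 / 2 * (-1 * 1) + 1 / 2 * (1 / 2) * (2 * 1)) =
      2 * (m : ℂ) - 1 / 2 := by ring
  rw [h, mul_assoc, one_div_mul_cancel hd, mul_one]

/-- The explicit state `ρ` is positive definite, has unit trace, and purity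
`1/(d − 1/2)` with `d = 2m`. -/
theorem min_purity_state_properties (m : ℕ) (hm : 1 ≤ m) :
    (minPurityState m).PosDef ∧ (minPurityState m).trace = 1 ∧
    ((minPurityState m) * (minPurityState m)).trace.re = 1 / (2 * (m : ℝ) - 1/2) := by
  refine ⟨minPurityState_posDef hm, trace_minPurityState hm, ?_⟩
  rw [trace_minPurityState_mul_self hm, Complex.ofReal_re]
end

section
/- Let m ≥ 1, d = 2m, and let ρ = (1/(d − 1/2)) I_d + (1/(2(d − 1/2))) (A − 2 I_2) ⊗ E with A = |0⟩⟨0| + |+⟩⟨+| + |+i⟩⟨+i| and E the projector onto the first standard basis vector of ℂ^m. Let σ be any density matrix on ℂ² ⊗ ℂ^m such that the 2×2 conditional matrix σ₀ = (I_2 ⊗ ⟨e₀|) σ (I_2 ⊗ |e₀⟩) (where e₀ is the first standard basis vector of ℂ^m) can be written as σ₀ = r·τ with r ≥ 0 and τ in the convex hull of the six single-qubit stabilizer pure states. Then Tr(ρσ) ≤ 1/(d − 1/2) = Tr(ρ²). (Hence ρ lies on a supporting hyperplane of the stabilizer polytope.) -/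
open Matrix
open scoped ComplexOrder Kronecker

theorem trace_kronecker_projE_mul {m : ℕ} (hm : 1 ≤ m) (B : Matrix (Fin 2) (Fin 2) ℂ)
    (X : Matrix (Fin 2 × Fin m) (Fin 2 × Fin m) ℂ) :
    ((B ⊗ₖ projE m) * X).trace =
      (B * Matrix.of fun j k => X (j, ⟨0, hm⟩) (k, ⟨0, hm⟩)).trace := by
  obtain ⟨n, rfl⟩ : ∃ n, m = n + 1 := ⟨m - 1, by omega⟩
  simp [Matrix.trace, Matrix.mul_apply, Fintype.sum_prod_type, projE, ite_and, Fin.sum_univ_succ]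

theorem trace_minPurityState_mul {m : ℕ} (hm : 1 ≤ m)
    (X : Matrix (Fin 2 × Fin m) (Fin 2 × Fin m) ℂ) :
    (minPurityState m * X).trace =
      ((1 / (2 * (m : ℝ) - 1/2) : ℝ) : ℂ) * X.trace +
      ((1 / (2 * (2 * (m : ℝ) - 1/2)) : ℝ) : ℂ) *
        ((matA - (2 : ℂ) • 1) *
          Matrix.of fun j k => X (j, ⟨0, hm⟩) (k, ⟨0, hm⟩)).trace := by
  rw [minPurityState, Matrix.add_mul, Matrix.smul_mul, Matrix.smul_mul, Matrix.one_mul,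
    Matrix.trace_add, Matrix.trace_smul, Matrix.trace_smul, trace_kronecker_projE_mul hm,
    smul_eq_mul, smul_eq_mul]

/-- The operator `A - 2I` is nonpositive in expectation on the stabilizer octahedron. -/
theorem trace_matA_sub_two_mul_re_nonpos {τ : Matrix (Fin 2) (Fin 2) ℂ}
    (hτ : τ ∈ convexHull ℝ stabStates) :
    ((matA - (2 : ℂ) • 1) * τ).trace.re ≤ 0 := by
  have hconv : Convex ℝ
      {τ : Matrix (Fin 2) (Fin 2) ℂ | ((matA - (2 : ℂ) • 1) * τ).trace.re ≤ 0} := by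
    intro x hx y hy a b ha hb _
    simp only [Set.mem_ofPred_eq, Matrix.mul_add, Matrix.mul_smul, Matrix.trace_add,
      Matrix.trace_smul, Complex.add_re, Complex.real_smul, Complex.re_ofReal_mul] at hx hy ⊢
    nlinarith [mul_nonneg ha (neg_nonneg.2 hx), mul_nonneg hb (neg_nonneg.2 hy)]
  refine convexHull_min ?_ hconv hτ
  rintro x (rfl | rfl | rfl | rfl | rfl | rfl) <;>
    simp [matA, ket0bra0, ket1bra1, ketPbraP, ketMbraM, ketPIbraPI, ketMIbraMI,
      Matrix.trace, Matrix.mul_apply, Fin.sum_univ_two] <;> norm_num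

/-- **`ρ` lies on a supporting hyperplane of the stabilizer polytope.** For any density
matrix `σ` on `ℂ² ⊗ ℂ^m` whose conditional matrix `σ₀ = (I ⊗ ⟨e₀|) σ (I ⊗ |e₀⟩)` is a
nonnegative multiple of a single-qubit stabilizer mixed state,
`Tr(ρσ) ≤ 1/(d − 1/2) = Tr(ρ²)`. -/
theorem min_purity_state_supporting (m : ℕ) (hm : 1 ≤ m)
    (σ : Matrix (Fin 2 × Fin m) (Fin 2 × Fin m) ℂ)
    (hσ : σ.PosSemidef) (htr : σ.trace = 1)
    (σ0 : Matrix (Fin 2) (Fin 2) ℂ)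
    (hσ0 : σ0 = Matrix.of fun j k => σ (j, ⟨0, hm⟩) (k, ⟨0, hm⟩))
    (r : ℝ) (hr : 0 ≤ r) (τ : Matrix (Fin 2) (Fin 2) ℂ)
    (hτ : τ ∈ convexHull ℝ stabStates) (hdecomp : σ0 = (r : ℂ) • τ) :
    ((minPurityState m) * σ).trace.re ≤ 1 / (2 * (m : ℝ) - 1/2) ∧
    ((minPurityState m) * (minPurityState m)).trace.re = 1 / (2 * (m : ℝ) - 1/2) := by
  have hd : 0 < 2 * (m : ℝ) - 1 / 2 := by
    have : (1 : ℝ) ≤ m := by exact_mod_cast hm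
    linarith
  constructor
  · rw [trace_minPurityState_mul hm, htr, ← hσ0, hdecomp, Matrix.mul_smul, Matrix.trace_smul,
      smul_eq_mul, mul_one, Complex.add_re, Complex.ofReal_re, Complex.re_ofReal_mul,
      Complex.re_ofReal_mul]
    have h := mul_nonneg (by positivity : 0 ≤ 1 / (2 * (2 * (m : ℝ) - 1 / 2)))
      (mul_nonneg hr (neg_nonneg.2 (trace_matA_sub_two_mul_re_nonpos hτ)))
    linarith
  · have h0 : ((matA - (2 : ℂ) • 1) * Matrix.of fun j k =>
        minPurityState m (j, ⟨0, hm⟩) (k, ⟨0, hm⟩)).trace = 0 := by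
      simp [minPurityState, projE, matA, ket0bra0, ketPbraP, ketPIbraPI, Matrix.trace,
        Matrix.mul_apply, Fin.sum_univ_two, Matrix.one_apply]
      ring_nf
      simp [Complex.I_sq]
    rw [trace_minPurityState_mul hm, trace_minPurityState hm, h0, mul_one, mul_zero, add_zero,
      Complex.ofReal_re]
end

section
/- Let d ≥ 2 be an integer and let W be a d×d Hermitian matrix with Tr W = 1 such that Tr(Wρ) ≥ 0 for every d×d density matrix ρ with purity Tr(ρ²) ≤ 1/(d − 1/2). Then Tr(W²) ≤ 2; equivalently, Tr(W)/√(Tr(W²)) ≥ 1/√2. -/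
open Matrix
open scoped ComplexOrder

/-- The trace of a Hermitian matrix, as the real sum of its eigenvalues. -/
theorem Matrix.IsHermitian.re_trace_eq_sum_eigenvalues {n : Type*} [Fintype n] [DecidableEq n]
    {A : Matrix n n ℂ} (hA : A.IsHermitian) : A.trace.re = ∑ i, hA.eigenvalues i := by
  rw [hA.trace_eq_sum_eigenvalues]
  simp

/-- The trace of the square of a Hermitian matrix is the sum of its squared eigenvalues. -/
theorem Matrix.IsHermitian.re_trace_mul_self_eq_sum_eigenvalues_sq {n : Type*} [Fintype n]
    [DecidableEq n] {A : Matrix n n ℂ} (hA : A.IsHermitian) :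
    (A * A).trace.re = ∑ i, hA.eigenvalues i ^ 2 := by
  conv_lhs => rw [hA.spectral_theorem, ← map_mul, Unitary.conjStarAlgAut_apply, trace_mul_cycle,
    Unitary.coe_star_mul_self, one_mul, diagonal_mul_diagonal, trace_diagonal]
  simp [sq]

/-- A Hermitian matrix of trace one and purity less than `1 / (d - 1)` is positive semidefinite. -/
theorem Matrix.IsHermitian.posSemidef_of_purity_lt {n : Type*} [Fintype n]
    {A : Matrix n n ℂ} (hA : A.IsHermitian) (htr : A.trace = 1)
    (hpur : ((Fintype.card n : ℝ) - 1) * (A * A).trace.re < 1) : A.PosSemidef := by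
  classical
  rw [hA.posSemidef_iff_eigenvalues_nonneg]
  intro i
  by_contra! hi
  simp only [Pi.zero_apply] at hi
  have hsum := hA.re_trace_eq_sum_eigenvalues
  rw [htr, Complex.one_re, ← Finset.add_sum_erase _ _ (Finset.mem_univ i)] at hsum
  rw [hA.re_trace_mul_self_eq_sum_eigenvalues_sq,
    ← Finset.add_sum_erase _ _ (Finset.mem_univ i)] at hpur
  have hcs := sq_sum_le_card_mul_sum_sq (s := Finset.univ.erase i) (f := hA.eigenvalues)
  have hcard : 1 ≤ Fintype.card n := Fintype.card_pos_iff.mpr ⟨i⟩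
  rw [Finset.card_erase_of_mem (Finset.mem_univ i), Finset.card_univ, Nat.cast_sub hcard,
    Nat.cast_one] at hcs
  have hcard' : (0 : ℝ) ≤ Fintype.card n - 1 := by
    rw [sub_nonneg]
    exact_mod_cast hcard
  nlinarith [mul_nonneg hcard' (sq_nonneg (hA.eigenvalues i))]

/-- If a `d×d` Hermitian matrix `W` with `Tr W = 1` satisfies `Tr(Wρ) ≥ 0` for every
density matrix `ρ` of purity at most `1/(d − 1/2)`, then `Tr(W²) ≤ 2`; equivalently
`Tr(W)/√Tr(W²) ≥ 1/√2`. -/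
theorem witness_norm_bound (d : ℕ) (hd : 2 ≤ d)
    (W : Matrix (Fin d) (Fin d) ℂ) (hW : W.IsHermitian) (htr : W.trace = 1)
    (hpos : ∀ ρ : Matrix (Fin d) (Fin d) ℂ, ρ.PosSemidef → ρ.trace = 1 →
      (ρ * ρ).trace.re ≤ 1 / ((d : ℝ) - 1/2) → 0 ≤ (W * ρ).trace.re) :
    (W * W).trace.re ≤ 2 ∧ 1 / Real.sqrt 2 ≤ W.trace.re / Real.sqrt ((W * W).trace.re) := by
  have hd' : (2 : ℝ) ≤ d := by exact_mod_cast hd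
  have hd0 : (d : ℝ) ≠ 0 := by positivity
  have hs0 : 0 < (W * W).trace.re := by
    have hsum := hW.re_trace_eq_sum_eigenvalues
    have hcs := sq_sum_le_card_mul_sum_sq (s := Finset.univ) (f := hW.eigenvalues)
    rw [← hsum, ← hW.re_trace_mul_self_eq_sum_eigenvalues_sq, htr, Finset.card_univ,
      Fintype.card_fin, Complex.one_re] at hcs
    by_contra! h
    nlinarith
  have hs2 : (W * W).trace.re ≤ 2 := by
    by_contra! hs
    set s := (W * W).trace.re with hs_def
    set t := s - 1 / (d : ℝ) with ht_def
    have hinv : 1 / (d : ℝ) ≤ 1 / 2 := one_div_le_one_div_of_le two_pos hd'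
    have ht : 0 < t := by linarith
    have hd1 : (0 : ℝ) < 2 * d - 1 := by linarith
    set c := √(1 / (d * (2 * d - 1) * t)) with hc_def
    have hc2 : c ^ 2 = 1 / (d * (2 * d - 1) * t) := Real.sq_sqrt (by positivity)
    have hc2t : c ^ 2 * t = 1 / (d * (2 * d - 1)) := by
      rw [hc2]
      field_simp
    set a : ℝ := (1 + c) / d with ha_def
    set ρ : Matrix (Fin d) (Fin d) ℂ := a • 1 - c • W with hρ_def
    have hρ : ρ.IsHermitian :=
      (isHermitian_one.smul (IsSelfAdjoint.all a)).sub (hW.smul (IsSelfAdjoint.all c))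
    have hρtr : ρ.trace = 1 := by
      simp [hρ_def, htr, ha_def]
      field_simp
      ring
    have hWρ : (W * ρ).trace.re = 1 / d - c * t := by
      simp [hρ_def, mul_sub, htr, ha_def, ht_def, hs_def]
      field_simp
      ring
    have hρρ : (ρ * ρ).trace.re = 1 / d + c ^ 2 * t := by
      have : ρ * ρ = (a ^ 2) • 1 - (2 * a * c) • W + (c ^ 2) • (W * W) := by
        simp only [hρ_def, sub_mul, mul_sub, smul_mul_assoc, mul_smul_comm, one_mul, mul_one]
        module
      rw [this]
      simp [htr, ha_def, ht_def, hs_def, -Complex.ofReal_pow, -Complex.ofReal_mul]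
      field_simp
      ring
    have hpur : (ρ * ρ).trace.re = 1 / ((d : ℝ) - 1 / 2) := by
      have hhalf : (d : ℝ) - 1 / 2 = (2 * d - 1) / 2 := by ring
      rw [hρρ, hc2t, hhalf, div_add_div _ _ hd0 (by positivity),
        div_eq_div_iff (by positivity) (by positivity)]
      ring
    have hpsd : ρ.PosSemidef := by
      refine hρ.posSemidef_of_purity_lt hρtr ?_
      rw [hpur, Fintype.card_fin, mul_one_div, div_lt_one (by linarith)]
      linarith
    have hct : c * t ≤ 1 / d := by
      have := hpos ρ hpsd hρtr hpur.le
      linarith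
    have hsq : (c * t) ^ 2 ≤ (1 / d) ^ 2 := pow_le_pow_left₀ (by positivity) hct 2
    have : (c * t) ^ 2 = t / (d * (2 * d - 1)) := by
      rw [mul_pow, sq t, ← mul_assoc, hc2t]
      ring
    rw [this, div_le_iff₀ (by positivity)] at hsq
    have : (1 / (d : ℝ)) ^ 2 * (d * (2 * d - 1)) = 2 - 1 / d := by field_simp
    linarith
  refine ⟨hs2, ?_⟩
  rw [htr, Complex.one_re]
  exact one_div_le_one_div_of_le (Real.sqrt_pos.mpr hs0) (Real.sqrt_le_sqrt hs2)
end

section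
/- Let ρ be a d×d density matrix and ψ ∈ ℂ^d a unit vector. Then ⟨ψ, ρψ⟩ ≤ 1/d + √(((d−1)/d)·(Tr(ρ²) − 1/d)). -/
open Matrix
open scoped ComplexOrder

/-- Cauchy–Schwarz for the Hilbert–Schmidt inner product on Hermitian matrices. -/
theorem Matrix.IsHermitian.sq_re_trace_mul_le {n : Type*} [Fintype n] {A B : Matrix n n ℂ}
    (hA : A.IsHermitian) (hB : B.IsHermitian) :
    (A * B).trace.re ^ 2 ≤ (B * B).trace.re * (A * A).trace.re := by
  have key : ∀ t : ℝ, 0 ≤ (B * B).trace.re * (t * t) + (-2 * (A * B).trace.re) * t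
      + (A * A).trace.re := by
    intro t
    have h := (posSemidef_conjTranspose_mul_self (A - (t : ℂ) • B)).trace_nonneg
    have hH : (A - (t : ℂ) • B)ᴴ = A - (t : ℂ) • B := by
      rw [conjTranspose_sub, conjTranspose_smul, hA.eq, hB.eq]
      simp
    rw [hH] at h
    have h' := (Complex.le_def.mp h).1
    simp only [sub_mul, mul_sub, Matrix.smul_mul, Matrix.mul_smul, trace_sub, trace_smul,
      smul_eq_mul, trace_mul_comm B A, Complex.sub_re, Complex.re_ofReal_mul,
      Complex.zero_re] at h'
    linarith
  have h := discrim_le_zero key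
  rw [discrim] at h
  linarith

/-- **Samuelson-type fidelity bound.** For a `d×d` density matrix `ρ` and a unit vector
`ψ ∈ ℂ^d`, `⟨ψ, ρψ⟩ ≤ 1/d + √(((d−1)/d)(Tr(ρ²) − 1/d))`. -/
theorem fidelity_purity_bound (d : ℕ) (hd : 1 ≤ d)
    (ρ : Matrix (Fin d) (Fin d) ℂ) (hρ : ρ.PosSemidef) (htr : ρ.trace = 1)
    (ψ : Fin d → ℂ) (hψ : ∑ i, Complex.normSq (ψ i) = 1) :
    (star ψ ⬝ᵥ ρ.mulVec ψ).re ≤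
      1 / (d : ℝ) + Real.sqrt ((((d : ℝ) - 1) / d) * ((ρ * ρ).trace.re - 1 / d)) := by
  have hd0 : (d : ℂ) ≠ 0 := by exact_mod_cast (by omega : d ≠ 0)
  have hψ' : ψ ⬝ᵥ star ψ = 1 := by
    simp only [dotProduct, Pi.star_apply, RCLike.star_def, Complex.mul_conj]
    exact_mod_cast hψ
  have hψ'' : star ψ ⬝ᵥ ψ = 1 := by rw [dotProduct_comm, hψ']
  have hone : (((d : ℂ)⁻¹) • (1 : Matrix (Fin d) (Fin d) ℂ)).IsHermitian := by
    simp [IsHermitian, conjTranspose_smul]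
  have hP : (vecMulVec ψ (star ψ)).IsHermitian := by
    simp [IsHermitian, conjTranspose_vecMulVec]
  have hcs := (hρ.isHermitian.sub hone).sq_re_trace_mul_le (hP.sub hone)
  have h1 : ((ρ - (d : ℂ)⁻¹ • 1) * (vecMulVec ψ (star ψ) - (d : ℂ)⁻¹ • 1)).trace
      = star ψ ⬝ᵥ ρ.mulVec ψ - ((1 / d : ℝ) : ℂ) := by
    simp only [sub_mul, mul_sub, Matrix.mul_smul, trace_sub, trace_smul,
      mul_one, mul_vecMulVec, smul_mulVec, one_mulVec, smul_dotProduct, trace_vecMulVec, htr,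
      hψ', trace_one, Fintype.card_fin,
      smul_eq_mul, dotProduct_comm (ρ.mulVec ψ)]
    push_cast
    field_simp
    ring
  have h2 : ((vecMulVec ψ (star ψ) - (d : ℂ)⁻¹ • 1) *
      (vecMulVec ψ (star ψ) - (d : ℂ)⁻¹ • 1)).trace = ((((d : ℝ) - 1) / d : ℝ) : ℂ) := by
    simp only [sub_mul, mul_sub, Matrix.smul_mul, Matrix.mul_smul, trace_sub, trace_smul,
      mul_one, one_mul, vecMulVec_mul_vecMulVec, trace_vecMulVec, hψ', hψ'', trace_one,
      Fintype.card_fin, smul_eq_mul, one_smul]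
    push_cast
    field_simp
    ring
  have h3 : ((ρ - (d : ℂ)⁻¹ • 1) * (ρ - (d : ℂ)⁻¹ • 1)).trace
      = (ρ * ρ).trace - ((1 / d : ℝ) : ℂ) := by
    simp only [sub_mul, mul_sub, Matrix.smul_mul, Matrix.mul_smul, trace_sub, trace_smul,
      mul_one, one_mul, htr, trace_one, Fintype.card_fin, smul_eq_mul]
    push_cast
    field_simp
    ring
  rw [h1, h2, h3, Complex.sub_re, Complex.sub_re, Complex.ofReal_re, Complex.ofReal_re] at hcs
  linarith [Real.le_sqrt_of_sq_le hcs]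
end

section
/- Let d ≥ 3 be an integer and let ρ be a d×d density matrix with purity Tr(ρ²) ≤ 1/(d − 1/2). Then for every unit vector ψ ∈ ℂ^d, ⟨ψ, ρψ⟩ < 3/(d + 2). (Hence any state of purity at most 1/(d − 1/2) has fidelity less than 3/(d+2) with every pure state, and therefore cannot be detected by any fidelity-based witness of the form αI − |ψ⟩⟨ψ| with α ≥ 3/(d+2): it is an unfaithful state.) -/
open Matrix
open scoped ComplexOrder

theorem Matrix.IsHermitian.trace_mul_self_re_nonneg {n : Type*} [Fintype n]
    {A : Matrix n n ℂ} (hA : A.IsHermitian) : 0 ≤ (A * A).trace.re := by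
  have h := (posSemidef_conjTranspose_mul_self A).trace_nonneg
  rw [hA.eq] at h
  exact (Complex.le_def.mp h).1

theorem Matrix.trace_mul_vecMulVec_star {n : Type*} [Fintype n] (A : Matrix n n ℂ) (v : n → ℂ) :
    (A * vecMulVec v (star v)).trace = star v ⬝ᵥ A.mulVec v := by
  rw [mul_vecMulVec, trace_vecMulVec, dotProduct_comm]

/-- **Unfaithful states.** Any `d×d` density matrix (`d ≥ 3`) of purity at most
`1/(d − 1/2)` has fidelity strictly less than `3/(d+2)` with every pure state, hence
cannot be detected by any fidelity-based witness `αI − |ψ⟩⟨ψ|` with `α ≥ 3/(d+2)`. -/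
theorem unfaithful_state (d : ℕ) (hd : 3 ≤ d)
    (ρ : Matrix (Fin d) (Fin d) ℂ) (hρ : ρ.PosSemidef) (htr : ρ.trace = 1)
    (hpur : (ρ * ρ).trace.re ≤ 1 / ((d : ℝ) - 1/2)) :
    ∀ ψ : Fin d → ℂ, (∑ i, Complex.normSq (ψ i) = 1) →
      (star ψ ⬝ᵥ ρ.mulVec ψ).re < 3 / ((d : ℝ) + 2) := by
  intro ψ hψ
  by_contra! hf
  have hnorm : star ψ ⬝ᵥ ψ = 1 := by
    simp only [dotProduct, Pi.star_apply, Complex.star_def, ← Complex.normSq_eq_conj_mul_self]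
    exact_mod_cast hψ
  set P := vecMulVec ψ (star ψ) with hP
  have hPh : P.IsHermitian := by
    rw [Matrix.IsHermitian, hP, conjTranspose_vecMulVec, star_star]
  have hPtr : P.trace = 1 := by rw [hP, trace_vecMulVec, dotProduct_comm, hnorm]
  have hPP : (P * P).trace = 1 := by
    rw [hP, vecMulVec_mul_vecMulVec, hnorm, one_smul, ← hP, hPtr]
  have hρP : (ρ * P).trace = star ψ ⬝ᵥ ρ.mulVec ψ := trace_mul_vecMulVec_star ρ ψ
  have hPρ : (P * ρ).trace = star ψ ⬝ᵥ ρ.mulVec ψ := by rw [trace_mul_comm, hρP]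
  -- Expand `0 ≤ Tr X²` for `X = (d + 2) ρ - 2 P - I`.
  have hX : (((d : ℝ) + 2) • ρ - (2 : ℝ) • P - 1).IsHermitian :=
    ((hρ.isHermitian.smul (IsSelfAdjoint.all _)).sub
      (hPh.smul (IsSelfAdjoint.all _))).sub isHermitian_one
  have key := hX.trace_mul_self_re_nonneg
  simp only [sub_mul, mul_sub, smul_mul_assoc, mul_smul_comm, one_mul, mul_one, trace_sub,
    trace_smul, trace_one, hρP, hPρ, hPP, hPtr, htr, Complex.sub_re, Complex.smul_re,
    Complex.one_re, Fintype.card_fin, Complex.natCast_re, smul_eq_mul] at key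
  have hd' : (3 : ℝ) ≤ d := by exact_mod_cast hd
  rw [div_le_iff₀ (by linarith)] at hf
  rw [le_div_iff₀ (by linarith)] at hpur
  have hlow : (d : ℝ) + 8 ≤ (ρ * ρ).trace.re * ((d : ℝ) + 2) ^ 2 := by nlinarith
  have h₁ := mul_le_mul_of_nonneg_right hlow (by linarith : (0 : ℝ) ≤ d - 1 / 2)
  have h₂ := mul_le_mul_of_nonneg_right hpur (sq_nonneg ((d : ℝ) + 2))
  nlinarith
end

section
/- Let d ≥ 1 and N ≥ 1 be integers, let ψ, φ_1, …, φ_N be unit vectors in ℂ^d, and set x_i = |⟨φ_i, ψ⟩|². If (1/N)·Σ_{i=1}^N x_i² = 2/(d(d+1)) and (1/N)·Σ_{i=1}^N x_i³ = 6/(d(d+1)(d+2)), then max_i x_i ≥ 3/(d+2). (These moment conditions hold in particular when the φ_i form a complex projective 3-design, e.g. the set of pure stabilizer states; hence every fidelity-based magic witness αI − |ψ⟩⟨ψ| requires α ≥ 3/(d+2).) -/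
open Matrix

/-- **Third-moment lower bound on the maximal overlap.** If unit vectors `φ_1, …, φ_N`
have squared overlaps `x_i = |⟨φ_i, ψ⟩|²` with a unit vector `ψ` whose second and third
moments match those of a complex projective 3-design, then some `x_i ≥ 3/(d+2)`. -/
theorem max_overlap_three_design (d N : ℕ) (hd : 1 ≤ d) (hN : 1 ≤ N)
    (ψ : Fin d → ℂ) (hψ : ∑ i, Complex.normSq (ψ i) = 1)
    (φ : Fin N → Fin d → ℂ) (hφ : ∀ i, ∑ j, Complex.normSq (φ i j) = 1)
    (x : Fin N → ℝ) (hx : ∀ i, x i = Complex.normSq (star (φ i) ⬝ᵥ ψ))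
    (h2 : (1 / (N : ℝ)) * ∑ i, (x i) ^ 2 = 2 / ((d : ℝ) * ((d : ℝ) + 1)))
    (h3 : (1 / (N : ℝ)) * ∑ i, (x i) ^ 3 = 6 / ((d : ℝ) * ((d : ℝ) + 1) * ((d : ℝ) + 2))) :
    ∃ i, 3 / ((d : ℝ) + 2) ≤ x i := by
  by_contra! hlt
  have hd' : (0 : ℝ) < d := by exact_mod_cast hd
  have hN' : (0 : ℝ) < N := by exact_mod_cast hN
  have hmoment : (1 / (N : ℝ)) * ∑ i, (x i) ^ 3
      = 3 / ((d : ℝ) + 2) * ((1 / (N : ℝ)) * ∑ i, (x i) ^ 2) := by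
    rw [h2, h3]
    field_simp
    norm_num
  have hsum : ∑ i, (x i) ^ 2 * (3 / ((d : ℝ) + 2) - x i) = 0 := by
    have hdiff : ∑ i, (x i) ^ 2 * (3 / ((d : ℝ) + 2) - x i)
        = 3 / ((d : ℝ) + 2) * ∑ i, (x i) ^ 2 - ∑ i, (x i) ^ 3 := by
      rw [Finset.mul_sum, ← Finset.sum_sub_distrib]
      exact Finset.sum_congr rfl fun i _ => by ring
    rw [mul_left_comm] at hmoment
    rw [hdiff, mul_left_cancel₀ (one_div_pos.mpr hN').ne' hmoment, sub_self]
  have hterm := (Finset.sum_eq_zero_iff_of_nonneg fun i _ =>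
    mul_nonneg (sq_nonneg (x i)) (sub_pos.mpr (hlt i)).le).mp hsum
  have hsq : ∑ i, (x i) ^ 2 = 0 := Finset.sum_eq_zero fun i hi =>
    (mul_eq_zero.mp (hterm i hi)).resolve_right (sub_pos.mpr (hlt i)).ne'
  rw [hsq, mul_zero] at h2
  have hpos : 0 < 2 / ((d : ℝ) * ((d : ℝ) + 1)) := by positivity
  exact hpos.ne h2
end

section
/- Let d ≥ 2 be an integer and let P_1, …, P_{d²−1} be d×d complex Hermitian matrices satisfying P_i² = I_d, Tr P_i = 0, and Tr(P_i P_j) = 0 for all i ≠ j. Let t_1, …, t_{d²−1} be real numbers and set ρ = (1/d)(I_d + Σ_i t_i P_i). If Tr(ρ²) ≤ 1/(d − 1/d), then ρ lies in the convex hull (over ℝ) of the set {(1/d)I_d} ∪ {(1/d)(I_d + P_i) : i} ∪ {(1/d)(I_d − P_i) : i}. (In particular, since for the n-qubit Pauli basis each (1/d)(I ± P_i) is a mixture of stabilizer states, every state of purity at most 1/(d − 1/d) is a mixture of stabilizer states.) -/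
open Matrix
open scoped ComplexOrder

/-- A convex set containing `c` and all `c ± v i` contains `c + ∑ i, t i • v i` as soon as
`∑ i, |t i| ≤ 1`. -/
theorem Convex.add_sum_smul_mem_of_sum_abs_le_one {ι E : Type*} [Fintype ι] [AddCommGroup E]
    [Module ℝ E] {s : Set E} (hs : Convex ℝ s) {c : E} {v : ι → E} (hc : c ∈ s)
    (hadd : ∀ i, c + v i ∈ s) (hsub : ∀ i, c - v i ∈ s) {t : ι → ℝ} (ht : ∑ i, |t i| ≤ 1) :
    c + ∑ i, t i • v i ∈ s := by
  have hmem : ∀ o : Option ι, o.elim c (fun i => if 0 ≤ t i then c + v i else c - v i) ∈ s := by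
    rintro (_ | i)
    · exact hc
    · simp only [Option.elim_some]
      split_ifs
      exacts [hadd i, hsub i]
  have key := hs.sum_mem (t := Finset.univ) (w := fun o => o.elim (1 - ∑ i, |t i|) fun i => |t i|)
    (by
      rintro (_ | i) -
      · simpa using ht
      · simp)
    (by simp [Fintype.sum_option]) (fun o _ => hmem o)
  have hterm : ∀ i, |t i| • (if 0 ≤ t i then c + v i else c - v i) = |t i| • c + t i • v i := by
    intro i
    split_ifs with h
    · rw [abs_of_nonneg h, smul_add]
    · rw [abs_of_neg (not_le.mp h), smul_sub, neg_smul (t i) (v i), sub_neg_eq_add]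
  simp only [Fintype.sum_option, Option.elim_none, Option.elim_some, hterm,
    Finset.sum_add_distrib, ← Finset.sum_smul] at key
  rwa [← add_assoc, ← add_smul, sub_add_cancel, one_smul] at key

/-- Parseval's identity for `1 + ∑ i, a i • P i`, where the `P i` are traceless, pairwise
trace-orthogonal involutions. -/
theorem Matrix.trace_one_add_sum_smul_mul_self {ι n R : Type*} [Fintype ι] [Fintype n]
    [DecidableEq n] [CommRing R] {P : ι → Matrix n n R} (hInv : ∀ i, P i * P i = 1)
    (hTr : ∀ i, (P i).trace = 0) (hOrth : ∀ i j, i ≠ j → (P i * P j).trace = 0) (a : ι → R) :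
    ((1 + ∑ i, a i • P i) * (1 + ∑ i, a i • P i)).trace =
      Fintype.card n * (1 + ∑ i, a i ^ 2) := by
  classical
  have hPP : ∀ i j, (P i * P j).trace = if i = j then (Fintype.card n : R) else 0 := by
    intro i j
    split_ifs with h
    · rw [← h, hInv, trace_one]
    · exact hOrth i j h
  simp only [add_mul, mul_add, one_mul, mul_one, trace_add, trace_one, trace_sum, trace_smul, hTr,
    Finset.sum_const_zero, add_zero, zero_add, Finset.sum_mul, Finset.mul_sum,
    smul_mul_assoc, mul_smul_comm, hPP, smul_eq_mul, mul_ite, mul_zero,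
    Finset.sum_ite_eq', Finset.mem_univ, if_true]
  congr 1
  exact Finset.sum_congr rfl fun i _ => by ring

/-- **Low-purity states are mixtures of `(I ± P)/d`.** Let `P_1, …, P_{d²−1}` be traceless
Hermitian involutions that are pairwise trace-orthogonal, and let
`ρ = (1/d)(I + Σ t_i P_i)`. If `Tr(ρ²) ≤ 1/(d − 1/d)` then `ρ` lies in the convex hull of
`(1/d)I` together with the matrices `(1/d)(I ± P_i)`. -/
theorem low_purity_pauli_mixture (d : ℕ) (hd : 2 ≤ d)
    (P : Fin (d ^ 2 - 1) → Matrix (Fin d) (Fin d) ℂ)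
    (hHerm : ∀ i, (P i).IsHermitian)
    (hInv : ∀ i, P i * P i = 1)
    (hTr : ∀ i, (P i).trace = 0)
    (hOrth : ∀ i j, i ≠ j → (P i * P j).trace = 0)
    (t : Fin (d ^ 2 - 1) → ℝ)
    (ρ : Matrix (Fin d) (Fin d) ℂ)
    (hρ : ρ = ((d : ℂ))⁻¹ • ((1 : Matrix (Fin d) (Fin d) ℂ) + ∑ i, (t i : ℂ) • P i))
    (hpur : (ρ * ρ).trace.re ≤ 1 / ((d : ℝ) - 1 / d)) :
    ρ ∈ convexHull ℝ
      ({((d : ℂ))⁻¹ • (1 : Matrix (Fin d) (Fin d) ℂ)} ∪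
        Set.range (fun i => ((d : ℂ))⁻¹ • ((1 : Matrix (Fin d) (Fin d) ℂ) + P i)) ∪
        Set.range (fun i => ((d : ℂ))⁻¹ • ((1 : Matrix (Fin d) (Fin d) ℂ) - P i))) := by
  have hd0 : (0 : ℝ) < d := by positivity
  have hd1 : (1 : ℝ) < (d : ℝ) ^ 2 := by
    have : (2 : ℝ) ≤ d := by exact_mod_cast hd
    nlinarith
  have hpurity : (ρ * ρ).trace.re = (1 + ∑ i, t i ^ 2) / d := by
    have h : (ρ * ρ).trace = (((1 + ∑ i, t i ^ 2) / d : ℝ) : ℂ) := by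
      have hdc : (d : ℂ) ≠ 0 := by exact_mod_cast hd0.ne'
      rw [hρ, smul_mul_assoc, mul_smul_comm, trace_smul, trace_smul,
        trace_one_add_sum_smul_mul_self hInv hTr hOrth, Fintype.card_fin]
      push_cast
      simp only [smul_eq_mul]
      field_simp
    rw [h, Complex.ofReal_re]
  have hcard : ((d ^ 2 - 1 : ℕ) : ℝ) = (d : ℝ) ^ 2 - 1 := by
    rw [Nat.cast_sub (Nat.one_le_pow _ _ (by omega))]
    push_cast
    rfl
  have hsq : ((d : ℝ) ^ 2 - 1) * ∑ i, t i ^ 2 ≤ 1 := by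
    have hbound : 1 / ((d : ℝ) - 1 / d) = d / ((d : ℝ) ^ 2 - 1) := by
      have : (d : ℝ) - 1 / d = ((d : ℝ) ^ 2 - 1) / d := by field_simp
      rw [this, one_div_div]
    rw [hpurity, hbound, div_le_div_iff₀ hd0 (by linarith)] at hpur
    linarith
  have habs : ∑ i, |t i| ≤ 1 := by
    have hcs := sq_sum_le_card_mul_sum_sq (s := Finset.univ) (f := fun i => |t i|)
    simp only [sq_abs, Finset.card_univ, Fintype.card_fin, hcard] at hcs
    exact (sq_le_one_iff₀ (Finset.sum_nonneg fun i _ => abs_nonneg (t i))).mp (hcs.trans hsq)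
  have hdecomp : ρ = (d : ℂ)⁻¹ • 1 + ∑ i, t i • ((d : ℂ)⁻¹ • P i) := by
    rw [hρ, smul_add, Finset.smul_sum]
    congr 1
    refine Finset.sum_congr rfl fun i _ => ?_
    rw [smul_comm, Complex.coe_smul]
  rw [hdecomp]
  exact (convex_convexHull ℝ _).add_sum_smul_mem_of_sum_abs_le_one
    (subset_convexHull ℝ _ (.inl (.inl rfl)))
    (fun i => subset_convexHull ℝ _ (.inl (.inr ⟨i, smul_add _ _ _⟩)))
    (fun i => subset_convexHull ℝ _ (.inr ⟨i, smul_sub _ _ _⟩)) habs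
end

section
/- For every real number p with 2/3 < p ≤ 1, there exists a 2×2 density matrix ρ with purity Tr(ρ²) = p that does not lie in the convex hull of the six single-qubit stabilizer pure states. (Hence the purity threshold 2/3 = 1/(2 − 1/2) for single-qubit magic states is sharp.) -/
open Matrix
open scoped ComplexOrder

/-- The qubit operator with Bloch vector `(r, r, r)`. -/
noncomputable def diagonalBlochState (r : ℝ) : Matrix (Fin 2) (Fin 2) ℂ :=
  !![(1 + r) / 2, (r - r * Complex.I) / 2; (r + r * Complex.I) / 2, (1 - r) / 2]

/-- The sum of the three Bloch coordinates of a Hermitian `2 × 2` matrix. -/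
def blochSum (M : Matrix (Fin 2) (Fin 2) ℂ) : ℝ :=
  (M 0 0).re - (M 1 1).re + 2 * (M 1 0).re + 2 * (M 1 0).im

lemma isLinearMap_blochSum : IsLinearMap ℝ blochSum where
  map_add M N := by simp [blochSum]; ring
  map_smul c M := by simp [blochSum]; ring

lemma blochSum_le_one_of_mem_convexHull {M : Matrix (Fin 2) (Fin 2) ℂ}
    (hM : M ∈ convexHull ℝ stabStates) : blochSum M ≤ 1 := by
  refine convexHull_min ?_ (convex_halfSpace_le isLinearMap_blochSum 1) hM
  rintro N (rfl | rfl | rfl | rfl | rfl | rfl) <;>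
    norm_num [blochSum, ket0bra0, ket1bra1, ketPbraP, ketMbraM, ketPIbraPI, ketMIbraMI]

lemma blochSum_diagonalBlochState (r : ℝ) : blochSum (diagonalBlochState r) = 3 * r := by
  simp [blochSum, diagonalBlochState]
  ring

/-- A Hermitian `2 × 2` matrix with trace one and nonnegative determinant is positive
semidefinite, since `M = Mᴴ * M + det M • 1` by Cayley-Hamilton. -/
lemma Matrix.IsHermitian.posSemidef_of_trace_eq_one {M : Matrix (Fin 2) (Fin 2) ℂ}
    (hM : M.IsHermitian) (htr : M.trace = 1) (hdet : 0 ≤ M.det) : M.PosSemidef := by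
  have key : M = Mᴴ * M + M.det • (1 : Matrix (Fin 2) (Fin 2) ℂ) := by
    rw [hM.eq]
    have h : M 1 1 = 1 - M 0 0 := by
      rw [← htr, trace_fin_two]
      ring
    ext i j
    fin_cases i <;> fin_cases j <;> simp [mul_apply, det_fin_two, h] <;> ring
  rw [key]
  exact (posSemidef_conjTranspose_mul_self M).add (PosSemidef.one.smul hdet)

lemma trace_diagonalBlochState (r : ℝ) : (diagonalBlochState r).trace = 1 := by
  simp [diagonalBlochState, trace_fin_two]
  ring

lemma det_diagonalBlochState (r : ℝ) :
    (diagonalBlochState r).det = ((1 - 3 * r ^ 2) / 4 : ℝ) := by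
  simp [diagonalBlochState, det_fin_two]
  linear_combination (r : ℂ) ^ 2 / 4 * Complex.I_sq

lemma isHermitian_diagonalBlochState (r : ℝ) : (diagonalBlochState r).IsHermitian := by
  ext i j
  fin_cases i <;> fin_cases j <;> simp [diagonalBlochState] <;> ring

lemma purity_diagonalBlochState (r : ℝ) :
    (diagonalBlochState r * diagonalBlochState r).trace.re = (1 + 3 * r ^ 2) / 2 := by
  simp [diagonalBlochState, trace_fin_two]
  ring

/-- **Sharpness of the purity threshold `2/3`.** For every `p` with `2/3 < p ≤ 1` there
is a single-qubit density matrix of purity `p` that is not a mixture of the six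
stabilizer pure states. -/
theorem purity_threshold_sharp (p : ℝ) (hp1 : 2 / 3 < p) (hp2 : p ≤ 1) :
    ∃ ρ : Matrix (Fin 2) (Fin 2) ℂ, ρ.PosSemidef ∧ ρ.trace = 1 ∧
      (ρ * ρ).trace.re = p ∧ ρ ∉ convexHull ℝ stabStates := by
  have hr : √((2 * p - 1) / 3) ^ 2 = (2 * p - 1) / 3 := Real.sq_sqrt (by linarith)
  have hlt : 1 / 3 < √((2 * p - 1) / 3) := Real.lt_sqrt_of_sq_lt (by linarith)
  refine ⟨diagonalBlochState √((2 * p - 1) / 3), ?_, trace_diagonalBlochState _, ?_, ?_⟩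
  · refine (isHermitian_diagonalBlochState _).posSemidef_of_trace_eq_one
      (trace_diagonalBlochState _) ?_
    rw [det_diagonalBlochState, hr]
    exact Complex.zero_le_real.mpr (by linarith)
  · rw [purity_diagonalBlochState, hr]
    ring
  · intro hmem
    have h := blochSum_le_one_of_mem_convexHull hmem
    rw [blochSum_diagonalBlochState] at h
    linarith
end
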